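/- For all α₁, α₂ ∈ A, the minimizers satisfy ‖w*(α₁) − w*(α₂)‖₂ ≤ (2σ/μ)·‖α₁ − α₂‖₁. -/

import Mathlib

open MeasureTheory RealInnerProductSpace

/-- Quadratic growth of a strongly convex function away from a minimizer. -/
theorem StrongConvexOn.quadratic_growth_of_forall_le {W : Type*} [NormedAddCommGroup W]
    [InnerProductSpace ℝ W] {F : W → ℝ} {μ : ℝ} (hF : StrongConvexOn Set.univ μ F) {m : W}
    (hm : ∀ w, F m ≤ F w) (w : W) : μ / 2 * ‖w - m‖ ^ 2 ≤ F w - F m := by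
  by_contra! h
  have hE : 0 ≤ F w - F m := sub_nonneg.2 (hm w)
  set D := μ / 2 * ‖w - m‖ ^ 2 with hD
  set E := F w - F m with hE_def
  have hDpos : 0 < D := hE.trans_lt h
  set t := (D - E) / (2 * D) with ht
  have ht0 : 0 < t := div_pos (by linarith) (by linarith)
  have ht1 : t ≤ 1 := (div_le_one (by linarith)).2 (by linarith)
  have htD : t * D = (D - E) / 2 := by rw [ht]; field_simp
  have hsc := hF.2 (Set.mem_univ w) (Set.mem_univ m) ht0.le (sub_nonneg.2 ht1)
    (add_sub_cancel t 1)
  simp only [smul_eq_mul] at hsc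
  rw [← hD] at hsc
  have hle : 0 ≤ t * (E - (1 - t) * D) := by
    have := hm (t • w + (1 - t) • m)
    rw [hE_def]
    linarith
  have := nonneg_of_mul_nonneg_right hle ht0
  linarith

/-- A strongly convex function on a nontrivial space does not vanish on a nonempty open set. -/
theorem StrongConvexOn.exists_ne_zero_of_isOpen {W : Type*} [NormedAddCommGroup W]
    [InnerProductSpace ℝ W] [Nontrivial W] {F : W → ℝ} {μ : ℝ} (hμ : 0 < μ)
    (hF : StrongConvexOn Set.univ μ F) {U : Set W} (hU : IsOpen U) (hne : U.Nonempty) :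
    ∃ w ∈ U, F w ≠ 0 := by
  by_contra! h
  obtain ⟨x, hx⟩ := hne
  obtain ⟨r, hr, hball⟩ := Metric.isOpen_iff.1 hU x hx
  obtain ⟨v, hv⟩ := exists_norm_eq W (half_pos hr).le
  have hy : x + v ∈ Metric.ball x r := by simp [hv, hr]
  have hmid := (convex_ball x r) (Metric.mem_ball_self hr) hy
    (by norm_num : (0 : ℝ) ≤ 1 / 2) (by norm_num : (0 : ℝ) ≤ 1 / 2) (by norm_num)
  have hsc := hF.2 (Set.mem_univ x) (Set.mem_univ (x + v))
    (by norm_num : (0 : ℝ) ≤ 1 / 2) (by norm_num : (0 : ℝ) ≤ 1 / 2) (by norm_num)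
  rw [h _ (hball hmid), h _ hx, h _ (hball hy)] at hsc
  have hnorm : ‖x - (x + v)‖ = r / 2 := by simp [hv]
  rw [hnorm] at hsc
  simp only [smul_eq_mul] at hsc
  have : 0 < μ * r ^ 2 := by positivity
  nlinarith

/-- A function with gradient bounded by `C` on a convex set is `C`-Lipschitz there. -/
theorem Convex.abs_sub_le_of_norm_gradient_le {W : Type*} [NormedAddCommGroup W]
    [InnerProductSpace ℝ W] [CompleteSpace W] {g : W → ℝ} {g' : W → W} {s : Set W} {C : ℝ}
    (hs : Convex ℝ s) (hg : ∀ w ∈ s, HasGradientAt g (g' w) w) (hC : ∀ w ∈ s, ‖g' w‖ ≤ C)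
    {x y : W} (hx : x ∈ s) (hy : y ∈ s) : |g y - g x| ≤ C * ‖y - x‖ :=
  hs.norm_image_sub_le_of_norm_hasFDerivWithin_le
    (fun w hw => (hg w hw).hasFDerivAt.hasFDerivWithinAt)
    (fun w hw => by simpa using hC w hw) hx hy

/-- For losses whose gradients are uniformly bounded on every ball, the set of models with
integrable loss is closed. -/
theorem isClosed_setOf_integrable_of_norm_gradient_le {W : Type*} [NormedAddCommGroup W]
    [InnerProductSpace ℝ W] [CompleteSpace W] {Z : Type*} [MeasurableSpace Z] {p : Measure Z}
    [IsFiniteMeasure p] {f : W → Z → ℝ} {f' : W → Z → W}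
    (hgrad : ∀ z w, HasGradientAt (fun v => f v z) (f' w z) w) {C β : ℝ} (hβ : 0 ≤ β) {w₀ : W}
    (hbound : ∀ z w, ‖f' w z‖ ≤ C + β * ‖w - w₀‖) : IsClosed {w | Integrable (f w) p} := by
  refine isClosed_of_closure_subset fun w hw => ?_
  obtain ⟨u, hu, hlim⟩ := mem_closure_iff_seq_limit.1 hw
  have hmeas : AEStronglyMeasurable (f w) p :=
    aestronglyMeasurable_of_tendsto_ae Filter.atTop (fun n => (hu n).aestronglyMeasurable)
      (.of_forall fun z => (hgrad z w).continuousAt.tendsto.comp hlim)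
  set R := max ‖w - w₀‖ ‖u 0 - w₀‖ with hR
  have hdiff : Integrable (fun z => f w z - f (u 0) z) p := by
    refine .of_bound (hmeas.sub (hu 0).aestronglyMeasurable) ((C + β * R) * ‖w - u 0‖)
      (.of_forall fun z => ?_)
    refine (convex_closedBall w₀ R).abs_sub_le_of_norm_gradient_le (fun v _ => hgrad z v)
      (fun v hv => (hbound z v).trans ?_) ?_ ?_
    · rw [mem_closedBall_iff_norm] at hv
      gcongr
    · simp [dist_eq_norm, hR]
    · simp [dist_eq_norm, hR]
  exact (hdiff.add (hu 0)).congr (.of_forall fun z => sub_add_cancel _ _)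

/-- Theorem 1 of the paper: if the mixture weights `α₁, α₂` in the simplex `A`
are close in ℓ₁ distance, the associated minimizers `w*(α₁), w*(α₂)` of the averaged losses
are close: `‖w*(α₁) − w*(α₂)‖ ≤ 2σ‖α₁ − α₂‖₁/μ`, where `σ²` bounds
`β²‖w − w'‖² + 𝒢(α)` over `w, w'` in the convex hull `X` of the minimizers and `α ∈ A`. -/
theorem stmt1
    {W : Type*} [NormedAddCommGroup W] [InnerProductSpace ℝ W] [FiniteDimensional ℝ W]
    {Z : Type*} [MeasurableSpace Z] {K : ℕ}
    (p : Fin K → Measure Z) [∀ i, IsProbabilityMeasure (p i)]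
    (f : W → Z → ℝ) (f' : W → Z → W)
    (β μ : ℝ) (hβ : 0 < β) (hμ : 0 < μ)
    (hgrad : ∀ z w, HasGradientAt (fun v => f v z) (f' w z) w)
    (hconv : ∀ z, ConvexOn ℝ Set.univ (fun v => f v z))
    (hsmooth : ∀ z w w', ‖f' w z - f' w' z‖ ≤ β * ‖w - w'‖)
    (A : Set (Fin K → ℝ)) (hA : A = {a | (∀ i, 0 ≤ a i) ∧ ∑ i, a i = 1})
    (F : (Fin K → ℝ) → W → ℝ)
    (hF : ∀ a ∈ A, ∀ w, F a w = ∑ i, a i * ∫ z, f w z ∂(p i))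
    (hsc : ∀ a ∈ A, StrongConvexOn Set.univ μ (F a))
    (wstar : (Fin K → ℝ) → W)
    (hmin : ∀ a ∈ A, ∀ w, F a (wstar a) ≤ F a w)
    (𝒢 : (Fin K → ℝ) → ℝ) (h𝒢0 : ∀ a ∈ A, 0 ≤ 𝒢 a)
    (h𝒢 : ∀ a ∈ A, ∀ z, ‖f' (wstar a) z‖ ^ 2 ≤ 𝒢 a)
    (σ : ℝ) (hσ0 : 0 ≤ σ)
    (hσ : ∀ a ∈ A, ∀ w ∈ convexHull ℝ (wstar '' A), ∀ w' ∈ convexHull ℝ (wstar '' A),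
      β ^ 2 * ‖w - w'‖ ^ 2 + 𝒢 a ≤ σ ^ 2)
    (α₁ α₂ : Fin K → ℝ) (hα₁ : α₁ ∈ A) (hα₂ : α₂ ∈ A) :
    ‖wstar α₁ - wstar α₂‖ ≤ 2 * σ * (∑ i, |α₁ i - α₂ i|) / μ := by
  subst hA
  rcases subsingleton_or_nontrivial W with hW | hW
  · rw [Subsingleton.elim (wstar α₁) (wstar α₂), sub_self, norm_zero]
    positivity
  have hmem : ∀ {a}, a ∈ {a : Fin K → ℝ | (∀ i, 0 ≤ a i) ∧ ∑ i, a i = 1} →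
      wstar a ∈ convexHull ℝ (wstar '' {a | (∀ i, 0 ≤ a i) ∧ ∑ i, a i = 1}) :=
    fun ha => subset_convexHull ℝ _ (Set.mem_image_of_mem _ ha)
  have hstar : ∀ z, ‖f' (wstar α₁) z‖ ≤ σ := fun z =>
    abs_le_of_sq_le_sq' (by
      have := hσ α₁ hα₁ _ (hmem hα₁) _ (hmem hα₁)
      simp only [sub_self, norm_zero] at this
      linarith [h𝒢 α₁ hα₁ z]) hσ0 |>.2
  have hbound : ∀ z w, ‖f' w z‖ ≤ σ + β * ‖w - wstar α₁‖ := fun z w => by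
    have := norm_add_le (f' (wstar α₁) z) (f' w z - f' (wstar α₁) z)
    rw [add_sub_cancel] at this
    linarith [hstar z, hsmooth z w (wstar α₁)]
  have hint : ∀ i w, Integrable (f w) (p i) := by
    intro i
    by_contra! hne
    have hmemi : Pi.single i 1 ∈ {a : Fin K → ℝ | (∀ i, 0 ≤ a i) ∧ ∑ i, a i = 1} :=
      ⟨fun j => (Pi.single_nonneg.2 zero_le_one : (0 : Fin K → ℝ) ≤ Pi.single i 1) j, by simp⟩
    obtain ⟨w, hw, hw0⟩ := (hsc _ hmemi).exists_ne_zero_of_isOpen hμ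
      (isClosed_setOf_integrable_of_norm_gradient_le (p := p i) hgrad hβ.le hbound).isOpen_compl
      hne
    refine hw0 ?_
    rw [hF _ hmemi]
    simp [Pi.single_apply, integral_undef hw]
  have hlip : ∀ z, |f (wstar α₂) z - f (wstar α₁) z| ≤ 2 * σ * ‖wstar α₁ - wstar α₂‖ := by
    intro z
    rw [norm_sub_rev]
    refine (convex_convexHull ℝ _).abs_sub_le_of_norm_gradient_le (fun v _ => hgrad z v)
      (fun v hv => (hbound z v).trans ?_) (hmem hα₁) (hmem hα₂)
    have : β * ‖v - wstar α₁‖ ≤ σ := abs_le_of_sq_le_sq' (by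
      rw [mul_pow]
      linarith [hσ α₁ hα₁ _ hv _ (hmem hα₁), h𝒢0 α₁ hα₁]) hσ0 |>.2
    linarith
  have hlip_int : ∀ i, |∫ z, f (wstar α₂) z ∂(p i) - ∫ z, f (wstar α₁) z ∂(p i)| ≤
      2 * σ * ‖wstar α₁ - wstar α₂‖ := by
    intro i
    rw [← integral_sub (hint i _) (hint i _)]
    simpa using norm_integral_le_of_norm_le_const (μ := p i)
      (f := fun z => f (wstar α₂) z - f (wstar α₁) z) (.of_forall hlip)
  have h₁ := (hsc α₁ hα₁).quadratic_growth_of_forall_le (hmin α₁ hα₁) (wstar α₂)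
  have h₂ := (hsc α₂ hα₂).quadratic_growth_of_forall_le (hmin α₂ hα₂) (wstar α₁)
  rw [norm_sub_rev] at h₁
  have hsum : F α₁ (wstar α₂) - F α₁ (wstar α₁) + (F α₂ (wstar α₁) - F α₂ (wstar α₂)) ≤
      (∑ i, |α₁ i - α₂ i|) * (2 * σ * ‖wstar α₁ - wstar α₂‖) := by
    rw [hF α₁ hα₁, hF α₁ hα₁, hF α₂ hα₂, hF α₂ hα₂, ← Finset.sum_sub_distrib,
      ← Finset.sum_sub_distrib, ← Finset.sum_add_distrib, Finset.sum_mul]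
    refine Finset.sum_le_sum fun i _ => ?_
    calc _ = (α₁ i - α₂ i) * (∫ z, f (wstar α₂) z ∂(p i) - ∫ z, f (wstar α₁) z ∂(p i)) := by ring
      _ ≤ |α₁ i - α₂ i| * |∫ z, f (wstar α₂) z ∂(p i) - ∫ z, f (wstar α₁) z ∂(p i)| := by
        rw [← abs_mul]
        exact le_abs_self _
      _ ≤ _ := by gcongr; exact hlip_int i
  rw [le_div_iff₀ hμ]
  rcases (norm_nonneg (wstar α₁ - wstar α₂)).eq_or_lt with h0 | hpos
  · rw [← h0, zero_mul]
    positivity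
  · refine le_of_mul_le_mul_right ?_ hpos
    linarith
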